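/- arXiv:2505.05052 — 2 statements merged into one kernel-verified Lean document; each statement's English description precedes it below -/
import Mathlib

section
/- Fix μ ∈ ℝ and define, on the open set Ω = {(λ, ν, p_λ, p_ν) ∈ ℝ⁴ : cosh²λ ≠ cos²ν}, the functions H = (p_λ²/2 - cosh λ + p_ν²/2 + (1-2μ)·cos ν)/(cosh²λ - cos²ν) and G = ((p_λ²/2 - cosh λ)·cos²ν + (p_ν²/2 + (1-2μ)·cos ν)·cosh²λ)/(cosh²λ - cos²ν). Then at every point of Ω the canonical Poisson bracket of H and G vanishes: (∂H/∂λ)(∂G/∂p_λ) + (∂H/∂ν)(∂G/∂p_ν) - (∂H/∂p_λ)(∂G/∂λ) - (∂H/∂p_ν)(∂G/∂ν) = 0. -/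
/-- The canonical Poisson bracket of the Hamiltonian `H` of Euler's two-center problem in
elliptic coordinates and the first integral `G` vanishes at every point of
`Ω = {(λ, ν, p_λ, p_ν) : cosh²λ ≠ cos²ν}`. -/
theorem euler_poisson_bracket_vanishes (μ : ℝ) (H G : ℝ → ℝ → ℝ → ℝ → ℝ)
    (hH : ∀ lam nu plam pnu : ℝ, H lam nu plam pnu =
      (plam ^ 2 / 2 - Real.cosh lam + pnu ^ 2 / 2 + (1 - 2 * μ) * Real.cos nu) /
        (Real.cosh lam ^ 2 - Real.cos nu ^ 2))
    (hG : ∀ lam nu plam pnu : ℝ, G lam nu plam pnu =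
      ((plam ^ 2 / 2 - Real.cosh lam) * Real.cos nu ^ 2 +
        (pnu ^ 2 / 2 + (1 - 2 * μ) * Real.cos nu) * Real.cosh lam ^ 2) /
        (Real.cosh lam ^ 2 - Real.cos nu ^ 2))
    (lam nu plam pnu : ℝ) (hΩ : Real.cosh lam ^ 2 ≠ Real.cos nu ^ 2) :
    deriv (fun x => H x nu plam pnu) lam * deriv (fun x => G lam nu x pnu) plam +
      deriv (fun x => H lam x plam pnu) nu * deriv (fun x => G lam nu plam x) pnu -
      deriv (fun x => H lam nu x pnu) plam * deriv (fun x => G x nu plam pnu) lam -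
      deriv (fun x => H lam nu plam x) pnu * deriv (fun x => G lam x plam pnu) nu = 0 := by
  have hD : Real.cosh lam ^ 2 - Real.cos nu ^ 2 ≠ 0 := sub_ne_zero.mpr hΩ
  have dC := (Real.hasDerivAt_cosh lam).pow 2
  have dc := (Real.hasDerivAt_cos nu).pow 2
  have dDlam := dC.sub_const (Real.cos nu ^ 2)
  have dDnu := dc.const_sub (Real.cosh lam ^ 2)
  have da := (Real.hasDerivAt_cosh lam).const_sub (plam ^ 2 / 2)
  have db := ((Real.hasDerivAt_cos nu).const_mul (1 - 2 * μ)).const_add (pnu ^ 2 / 2)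
  have dplam := ((hasDerivAt_id plam).pow 2).div_const 2 |>.sub_const (Real.cosh lam)
  have dpnu := ((hasDerivAt_id pnu).pow 2).div_const 2
  have dpnu' := dpnu.add_const ((1 - 2 * μ) * Real.cos nu)
  have hHlam := ((da.add_const (pnu ^ 2 / 2)).add_const ((1 - 2 * μ) * Real.cos nu)).div dDlam hD
  have hHnu := (((Real.hasDerivAt_cos nu).const_mul (1 - 2 * μ)).const_add
    (plam ^ 2 / 2 - Real.cosh lam + pnu ^ 2 / 2)).div dDnu hD
  have hHplam := ((dplam.add_const (pnu ^ 2 / 2)).add_const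
    ((1 - 2 * μ) * Real.cos nu)).div_const (Real.cosh lam ^ 2 - Real.cos nu ^ 2)
  have hHpnu := ((dpnu.const_add (plam ^ 2 / 2 - Real.cosh lam)).add_const
    ((1 - 2 * μ) * Real.cos nu)).div_const (Real.cosh lam ^ 2 - Real.cos nu ^ 2)
  have hGlam := ((da.mul_const (Real.cos nu ^ 2)).add
    (dC.const_mul (pnu ^ 2 / 2 + (1 - 2 * μ) * Real.cos nu))).div dDlam hD
  have hGnu := ((dc.const_mul (plam ^ 2 / 2 - Real.cosh lam)).add
    (db.mul_const (Real.cosh lam ^ 2))).div dDnu hD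
  have hGplam := ((dplam.mul_const (Real.cos nu ^ 2)).add_const
    ((pnu ^ 2 / 2 + (1 - 2 * μ) * Real.cos nu) * Real.cosh lam ^ 2)).div_const
    (Real.cosh lam ^ 2 - Real.cos nu ^ 2)
  have hGpnu := ((dpnu'.mul_const (Real.cosh lam ^ 2)).const_add
    ((plam ^ 2 / 2 - Real.cosh lam) * Real.cos nu ^ 2)).div_const
    (Real.cosh lam ^ 2 - Real.cos nu ^ 2)
  simp only [hH, hG]
  erw [hHlam.deriv, hHnu.deriv, hHplam.deriv, hHpnu.deriv, hGlam.deriv, hGnu.deriv,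
    hGplam.deriv, hGpnu.deriv]
  simp only [Pi.add_apply, Pi.pow_apply, id]
  field_simp
  ring
end

section
/- Let μ, c ∈ ℝ and define U : ℝ → ℝ by U(x) = (1 - 2μ)·cos x + c·cos²x. Suppose ν, p : ℝ → ℝ are differentiable functions satisfying, for all t ∈ ℝ, ν'(t) = p(t) and p'(t) = (1 - 2μ)·sin(ν(t)) + 2·c·cos(ν(t))·sin(ν(t)), and suppose the initial energy e = p(0)²/2 + U(ν(0)) satisfies e > U(x) for every x ∈ ℝ. Then p(t) ≠ 0 for all t ∈ ℝ; moreover, if p(0) > 0 then ν is strictly monotone increasing on ℝ. -/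
/-- Conservation of energy for a one-dimensional Newtonian system with potential `U`. -/
theorem energy_eq_of_hasDerivAt {U U' ν p : ℝ → ℝ} (hU : ∀ x, HasDerivAt U (U' x) x)
    (hν : ∀ t, HasDerivAt ν (p t) t) (hp : ∀ t, HasDerivAt p (-U' (ν t)) t) (s t : ℝ) :
    p s ^ 2 / 2 + U (ν s) = p t ^ 2 / 2 + U (ν t) := by
  have hE : ∀ r, HasDerivAt (fun r => p r ^ 2 / 2 + U (ν r)) 0 r := fun r => by
    refine ((((hp r).pow 2).div_const 2).add ((hU (ν r)).comp r (hν r))).congr_deriv ?_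
    push_cast
    ring
  exact is_const_of_deriv_eq_zero (fun r => (hE r).differentiableAt) (fun r => (hE r).deriv) s t

/-- A continuous real function on `ℝ` without zeros which is positive at one point is positive. -/
theorem pos_of_continuous_of_ne_zero {f : ℝ → ℝ} (hf : Continuous f) (h0 : ∀ t, f t ≠ 0)
    {s : ℝ} (hs : 0 < f s) (t : ℝ) : 0 < f t := by
  by_contra! ht
  obtain ⟨r, hr⟩ := mem_range_of_exists_le_of_exists_ge hf ⟨t, ht⟩ ⟨s, hs.le⟩
  exact h0 r hr

/-- In the `ν`-subsystem of the regularized Euler two-center problem with potential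
`U(x) = (1-2μ)cos x + c cos²x`, if the energy `e = p(0)²/2 + U(ν(0))` exceeds `U`
everywhere (lemniscate motions), then `p` never vanishes, and if `p(0) > 0` then `ν` is
strictly increasing. -/
theorem lemniscate_momentum_never_vanishes (μ c : ℝ) (U : ℝ → ℝ)
    (hU : ∀ x : ℝ, U x = (1 - 2 * μ) * Real.cos x + c * Real.cos x ^ 2)
    (ν p : ℝ → ℝ) (hν : Differentiable ℝ ν) (hp : Differentiable ℝ p)
    (hν' : ∀ t : ℝ, deriv ν t = p t)
    (hp' : ∀ t : ℝ, deriv p t =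
      (1 - 2 * μ) * Real.sin (ν t) + 2 * c * Real.cos (ν t) * Real.sin (ν t))
    (he : ∀ x : ℝ, p 0 ^ 2 / 2 + U (ν 0) > U x) :
    (∀ t : ℝ, p t ≠ 0) ∧ (p 0 > 0 → StrictMono ν) := by
  have hU' : ∀ x, HasDerivAt U
      (-((1 - 2 * μ) * Real.sin x + 2 * c * Real.cos x * Real.sin x)) x := fun x => by
    rw [funext hU]
    refine (((Real.hasDerivAt_cos x).const_mul (1 - 2 * μ)).add
      (((Real.hasDerivAt_cos x).pow 2).const_mul c)).congr_deriv ?_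
    push_cast
    ring
  have energy := energy_eq_of_hasDerivAt hU' (fun t => hν' t ▸ (hν t).hasDerivAt)
    (fun t => by rw [neg_neg, ← hp' t]; exact (hp t).hasDerivAt)
  have hne : ∀ t, p t ≠ 0 := fun t ht => by
    have h := energy 0 t
    rw [ht] at h
    linarith [he (ν t)]
  exact ⟨hne, fun h0 => strictMono_of_deriv_pos fun t =>
    (hν' t).symm ▸ pos_of_continuous_of_ne_zero hp.continuous hne h0 t⟩
end
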